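/- arXiv:1806.01967 — 2 statements merged into one kernel-verified Lean document; each statement's English description precedes it below -/
import Mathlib

section
/- Let m ≥ 2 and let h : ℝ → ℝ be smooth with h(s) = 0 for all s in a neighborhood of [1,∞). Define φ^t(z) = exp(−2·i·h'(‖z‖²)·t)·z. Then each φ^t restricts to a compactly supported symplectomorphism of the open unit ball 𝔹 ⊂ ℂ^m, and the action of φ^t with respect to λ is given by σ_{φ^t}(z) = t·(h(‖z‖²) − ‖z‖²·h'(‖z‖²)); that is, this function vanishes near ∂𝔹 and satisfies D[σ_{φ^t}](z)v = λ_{φ^t(z)}(Dφ^t(z)v) − λ_z(v) for all z ∈ 𝔹 and v ∈ ℂ^m. -/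
open Metric MeasureTheory

noncomputable section

/-- `ℂ^m` with the Euclidean (ℓ²) norm, identified with `ℝ^{2m}`. -/
abbrev E (m : ℕ) := EuclideanSpace ℂ (Fin m)

/-- The standard symplectic form `ω(u,v) = Σᵢ Im(conj uᵢ · vᵢ)` on `ℂ^m`. -/
def stdOmega {m : ℕ} (u v : E m) : ℝ := ∑ i, ((starRingEnd ℂ) (u i) * v i).im

/-- The standard primitive `λ_z(v) = (1/2) Σᵢ Im(conj zᵢ · vᵢ)` of `ω`. -/
def stdLam {m : ℕ} (z v : E m) : ℝ := (1 / 2) * ∑ i, ((starRingEnd ℂ) (z i) * v i).im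

/-- A compactly supported symplectomorphism of the open unit ball `𝔹 ⊂ ℂ^m`:
a smooth diffeomorphism equal to the identity outside a compact subset of `𝔹`
whose derivative preserves the standard symplectic form. -/
def IsCSSymp {m : ℕ} (φ : E m → E m) : Prop :=
  ContDiff ℝ (⊤ : ℕ∞) φ ∧
  (∃ ψ : E m → E m, ContDiff ℝ (⊤ : ℕ∞) ψ ∧
    Function.LeftInverse ψ φ ∧ Function.RightInverse ψ φ) ∧
  (∃ K : Set (E m), IsCompact K ∧ K ⊆ ball 0 1 ∧ ∀ z ∉ K, φ z = z) ∧
  (∀ z u v, stdOmega (fderiv ℝ φ z u) (fderiv ℝ φ z v) = stdOmega u v)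

/-- `σ` is the action of `φ` with respect to the standard primitive `λ`:
a smooth function vanishing near `∂𝔹` with `dσ = φ*λ − λ` on `𝔹`. -/
def IsActionOf {m : ℕ} (φ : E m → E m) (σ : E m → ℝ) : Prop :=
  ContDiff ℝ (⊤ : ℕ∞) σ ∧
  (∃ K : Set (E m), IsCompact K ∧ K ⊆ ball 0 1 ∧ ∀ z ∉ K, σ z = 0) ∧
  (∀ z ∈ ball (0 : E m) 1, ∀ v,
    fderiv ℝ σ z v = stdLam (φ z) (fderiv ℝ φ z v) - stdLam z v)

section Form

variable {m : ℕ}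

lemma stdOmega_eq_im_inner (u v : E m) : stdOmega u v = (inner ℂ u v).im := by
  simp [stdOmega, PiLp.inner_apply, mul_comm]

lemma stdLam_eq_im_inner (z v : E m) : stdLam z v = (1 / 2) * (inner ℂ z v).im := by
  rw [← stdOmega_eq_im_inner]
  rfl

lemma real_inner_eq_re_inner_complex (u v : E m) : inner ℝ u v = (inner ℂ u v).re := by
  simp [PiLp.inner_apply]

/-- Multiplying both arguments by the same unit complex number preserves the inner product. -/
lemma inner_exp_smul_exp_smul (θ : ℝ) (u v : E m) :
    inner ℂ (Complex.exp (θ * Complex.I) • u) (Complex.exp (θ * Complex.I) • v)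
      = inner ℂ u v := by
  rw [inner_smul_left, inner_smul_right, ← mul_assoc, ← Complex.exp_conj, ← Complex.exp_add]
  simp

end Form

/-- The radial twist `z ↦ exp(i g(‖z‖²)) z`. -/
def radialTwist (m : ℕ) (g : ℝ → ℝ) (z : E m) : E m :=
  Complex.exp ((g (‖z‖ ^ 2) : ℂ) * Complex.I) • z

section RadialTwist

variable {m : ℕ} {g : ℝ → ℝ}

lemma norm_radialTwist (z : E m) : ‖radialTwist m g z‖ = ‖z‖ := by
  rw [radialTwist, norm_smul, Complex.norm_exp_ofReal_mul_I, one_mul]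

lemma contDiff_radialTwist (hg : ContDiff ℝ (⊤ : ℕ∞) g) :
    ContDiff ℝ (⊤ : ℕ∞) (radialTwist m g) := by
  have hn : ContDiff ℝ (⊤ : ℕ∞) (fun z : E m => g (‖z‖ ^ 2)) := hg.comp (contDiff_norm_sq ℝ)
  have he : ContDiff ℝ (⊤ : ℕ∞)
      (fun z : E m => Complex.exp ((g (‖z‖ ^ 2) : ℂ) * Complex.I)) :=
    ((Complex.ofRealCLM.contDiff.comp hn).mul contDiff_const).cexp
  exact he.smul contDiff_id

lemma radialTwist_neg_radialTwist (z : E m) :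
    radialTwist m (-g) (radialTwist m g z) = z := by
  rw [radialTwist, norm_radialTwist, radialTwist, smul_smul, ← Complex.exp_add]
  simp

lemma fderiv_radialTwist_apply (hg : Differentiable ℝ g) (z v : E m) :
    fderiv ℝ (radialTwist m g) z v = Complex.exp ((g (‖z‖ ^ 2) : ℂ) * Complex.I) •
      (v + (((deriv g (‖z‖ ^ 2) * (2 * (inner ℂ z v).re) : ℝ) : ℂ) * Complex.I) • z) := by
  have hn : HasFDerivAt (fun z : E m => g (‖z‖ ^ 2)) _ z :=
    (hg (‖z‖ ^ 2)).hasDerivAt.comp_hasFDerivAt z (hasStrictFDerivAt_norm_sq z).hasFDerivAt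
  have he := ((Complex.ofRealCLM.hasFDerivAt.comp z hn).mul_const Complex.I).cexp
  have ht : HasFDerivAt (radialTwist m g) _ z := he.smul (hasFDerivAt_id z)
  rw [ht.fderiv]
  simp [real_inner_eq_re_inner_complex, smul_smul, mul_assoc, mul_comm, mul_left_comm]

lemma stdOmega_fderiv_radialTwist (hg : Differentiable ℝ g) (z u v : E m) :
    stdOmega (fderiv ℝ (radialTwist m g) z u) (fderiv ℝ (radialTwist m g) z v)
      = stdOmega u v := by
  simp only [fderiv_radialTwist_apply hg, stdOmega_eq_im_inner, inner_exp_smul_exp_smul]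
  have hzz : (inner ℂ z z).im = 0 := inner_self_im (𝕜 := ℂ) z
  have huz : (inner ℂ u z).re = (inner ℂ z u).re := inner_re_symm (𝕜 := ℂ) u z
  simp [hzz, huz, -inner_self_eq_norm_sq_to_K]
  ring

lemma stdLam_radialTwist_fderiv (hg : Differentiable ℝ g) (z v : E m) :
    stdLam (radialTwist m g z) (fderiv ℝ (radialTwist m g) z v)
      = stdLam z v + ‖z‖ ^ 2 * deriv g (‖z‖ ^ 2) * (inner ℂ z v).re := by
  simp only [fderiv_radialTwist_apply hg, stdLam_eq_im_inner]
  rw [radialTwist, inner_exp_smul_exp_smul, inner_add_right, inner_smul_right,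
    inner_self_eq_norm_sq_to_K]
  simp [← Complex.ofReal_pow]
  ring

end RadialTwist

/-- A property of `z` valid for `‖z‖² > a`, where `a < 1`, holds off a compact subset of the
open unit ball. -/
lemma exists_isCompact_subset_ball {m : ℕ} {P : E m → Prop} {a : ℝ} (ha : a < 1)
    (hP : ∀ z, a < ‖z‖ ^ 2 → P z) :
    ∃ K : Set (E m), IsCompact K ∧ K ⊆ ball 0 1 ∧ ∀ z ∉ K, P z := by
  refine ⟨closedBall 0 √a, isCompact_closedBall _ _,
    closedBall_subset_ball ((Real.sqrt_lt' one_pos).2 (by simpa using ha)), fun z hz => hP z ?_⟩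
  rw [mem_closedBall_zero_iff, not_le] at hz
  exact Real.lt_sq_of_sqrt_lt hz

lemma fderiv_radial_action_apply {m : ℕ} {h : ℝ → ℝ} (hh : Differentiable ℝ h)
    (hh' : Differentiable ℝ (deriv h)) (t : ℝ) (z v : E m) :
    fderiv ℝ (fun z : E m => t * (h (‖z‖ ^ 2) - ‖z‖ ^ 2 * deriv h (‖z‖ ^ 2))) z v
      = -2 * t * ‖z‖ ^ 2 * deriv (deriv h) (‖z‖ ^ 2) * (inner ℂ z v).re := by
  have hs := ((hh (‖z‖ ^ 2)).hasDerivAt.sub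
    ((hasDerivAt_id (‖z‖ ^ 2)).mul (hh' (‖z‖ ^ 2)).hasDerivAt)).const_mul t
  have hc : HasFDerivAt (fun z : E m => t * (h (‖z‖ ^ 2) - ‖z‖ ^ 2 * deriv h (‖z‖ ^ 2))) _ z :=
    HasDerivAt.comp_hasFDerivAt (f := fun z : E m => ‖z‖ ^ 2)
      (h₂ := fun s => t * (h s - s * deriv h s)) z hs
      (hasStrictFDerivAt_norm_sq z).hasFDerivAt
  rw [hc.fderiv]
  simp [real_inner_eq_re_inner_complex]
  ring

/-- for a radial Hamiltonian vanishing near `[1,∞)`, the time-`t` maps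
`φ^t(z) = exp(−2·i·h'(‖z‖²)·t)·z` are compactly supported symplectomorphisms of the
open unit ball, with action `σ_{φ^t}(z) = t·(h(‖z‖²) − ‖z‖²·h'(‖z‖²))`. -/
theorem radial_hamiltonian_action (m : ℕ) (hm : 2 ≤ m)
    (h : ℝ → ℝ) (hh : ContDiff ℝ (⊤ : ℕ∞) h)
    (hvan : ∃ a : ℝ, a < 1 ∧ ∀ s : ℝ, a < s → h s = 0)
    (φ : ℝ → E m → E m)
    (hφ : ∀ t z, φ t z =
      Complex.exp (-(2 : ℂ) * Complex.I * (Complex.ofReal (deriv h (‖z‖ ^ 2))) * t) • z) :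
    ∀ t : ℝ, IsCSSymp (φ t) ∧
      IsActionOf (φ t) (fun z => t * (h (‖z‖ ^ 2) - ‖z‖ ^ 2 * deriv h (‖z‖ ^ 2))) := by
  intro t
  obtain ⟨a, ha, hzero⟩ := hvan
  have hdzero : ∀ s, a < s → deriv h s = 0 := fun s hs => by
    have heq : h =ᶠ[nhds s] fun _ => 0 := by
      filter_upwards [lt_mem_nhds hs] with x hx using hzero x hx
    simpa using heq.deriv_eq
  have hh' : ContDiff ℝ (⊤ : ℕ∞) (deriv h) := (contDiff_infty_iff_deriv.1 hh).2
  have hd : Differentiable ℝ h := hh.differentiable (by simp)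
  have hd' : Differentiable ℝ (deriv h) := hh'.differentiable (by simp)
  set g : ℝ → ℝ := fun s => -2 * t * deriv h s with hg_def
  have hg : ContDiff ℝ (⊤ : ℕ∞) g := contDiff_const.mul hh'
  have hgd : Differentiable ℝ g := hd'.const_mul _
  have hφg : φ t = radialTwist m g := by
    ext1 z
    rw [hφ, radialTwist]
    congr 2
    simp only [hg_def]
    push_cast
    ring
  rw [hφg]
  refine ⟨⟨contDiff_radialTwist hg, ⟨radialTwist m (-g), contDiff_radialTwist hg.neg,
    radialTwist_neg_radialTwist, fun z => ?_⟩, ?_, stdOmega_fderiv_radialTwist hgd⟩, ?_, ?_, ?_⟩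
  · simpa using radialTwist_neg_radialTwist (g := -g) z
  · exact exists_isCompact_subset_ball ha fun z hz => by
      simp [radialTwist, hg_def, hdzero _ hz]
  · have hn : ContDiff ℝ (⊤ : ℕ∞) (fun z : E m => ‖z‖ ^ 2) := contDiff_norm_sq ℝ
    exact contDiff_const.mul ((hh.comp hn).sub (hn.mul (hh'.comp hn)))
  · exact exists_isCompact_subset_ball ha fun z hz => by
      simp [hzero _ hz, hdzero _ hz]
  · intro z _ v
    rw [fderiv_radial_action_apply hd hd', stdLam_radialTwist_fderiv hgd, hg_def,
      deriv_const_mul _ (hd' _)]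
    ring
end
end

section
/- Let δ > 0, s > 0 and 0 < r₀ < r₁ < ρ < 1, and let f, g : [0,ρ] → ℝ be twice continuously differentiable functions satisfying: g(r) > 0 for all r ∈ [0,ρ]; g'(r) < 0 for all r ∈ (0,ρ]; f'(r)·g''(r) − f''(r)·g'(r) ≤ 0 for all r ∈ [0,ρ]; f(r) = 1 and g(r) = s·(1−r²) for all r ∈ [r₁,ρ]; and f(r) = r² and g(r) = 1+δ−r² for all r ∈ [0,r₀]. Define τ(r) = (f(r)·g'(r) − f'(r)·g(r))/((1+δ)·g'(r)) for r ∈ (0,ρ]. Then τ is monotone non-increasing on (0,ρ] and 1/(1+δ) ≤ τ(r) ≤ 1 for all r ∈ (0,ρ]. -/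
open Set

noncomputable section

/-- If `F` has derivative `F'` within `Icc c d` at a point `x` of a nondegenerate subinterval
`Icc a b` on which `F` agrees with `G`, and `G` has derivative `m` at `x`, then `F' = m`. -/
theorem HasDerivWithinAt.eq_of_eqOn_Icc {F G : ℝ → ℝ} {F' m a b c d x : ℝ}
    (hF : HasDerivWithinAt F F' (Icc c d) x) (hG : HasDerivAt G m x) (hab : a < b)
    (hsub : Icc a b ⊆ Icc c d) (hx : x ∈ Icc a b) (hFG : EqOn F G (Icc a b)) : F' = m :=
  (uniqueDiffOn_Icc hab x hx).eq_deriv _ (hF.mono hsub)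
    (hG.hasDerivWithinAt.congr hFG (hFG hx))

/-- The quotient rule for `(f g' - f' g) / (k g')`. -/
theorem HasDerivWithinAt.wronskian_div {f g f' g' : ℝ → ℝ} {f'' g'' k r : ℝ} {S : Set ℝ}
    (hf : HasDerivWithinAt f (f' r) S r) (hg : HasDerivWithinAt g (g' r) S r)
    (hf' : HasDerivWithinAt f' f'' S r) (hg' : HasDerivWithinAt g' g'' S r)
    (hk : k ≠ 0) (hr : g' r ≠ 0) :
    HasDerivWithinAt (fun r => (f r * g' r - f' r * g r) / (k * g' r))
      (g r * (f' r * g'' - f'' * g' r) / (k * g' r ^ 2)) S r := by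
  refine (((hf.mul hg').sub (hf'.mul hg)).div (hg'.const_mul k)
    (mul_ne_zero hk hr)).congr_deriv ?_
  simp only [Pi.mul_apply, Pi.sub_apply]
  field_simp
  ring

/-- the first-return-time computation near the binding. For `C²` functions
`f, g` on `[0,ρ]` with `g > 0`, `g' < 0` on `(0,ρ]`, `f'g'' − f''g' ≤ 0`, which equal the
model `(1, s(1−r²))` near `ρ` and `(r², 1+δ−r²)` near `0`, the return time
`τ(r) = (f·g' − f'·g)/((1+δ)·g')` is non-increasing on `(0,ρ]` and satisfies
`1/(1+δ) ≤ τ ≤ 1`. -/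
theorem return_time_bounds (δ s r₀ r₁ ρ : ℝ)
    (hδ : 0 < δ) (hs : 0 < s) (h0 : 0 < r₀) (h01 : r₀ < r₁) (h1ρ : r₁ < ρ) (hρ1 : ρ < 1)
    (f g f' g' f'' g'' : ℝ → ℝ)
    (hf' : ∀ r ∈ Icc 0 ρ, HasDerivWithinAt f (f' r) (Icc 0 ρ) r)
    (hg' : ∀ r ∈ Icc 0 ρ, HasDerivWithinAt g (g' r) (Icc 0 ρ) r)
    (hf'' : ∀ r ∈ Icc 0 ρ, HasDerivWithinAt f' (f'' r) (Icc 0 ρ) r)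
    (hg'' : ∀ r ∈ Icc 0 ρ, HasDerivWithinAt g' (g'' r) (Icc 0 ρ) r)
    (hf''c : ContinuousOn f'' (Icc 0 ρ)) (hg''c : ContinuousOn g'' (Icc 0 ρ))
    (hgpos : ∀ r ∈ Icc 0 ρ, 0 < g r)
    (hg'neg : ∀ r ∈ Ioc 0 ρ, g' r < 0)
    (hconv : ∀ r ∈ Icc 0 ρ, f' r * g'' r - f'' r * g' r ≤ 0)
    (houter : ∀ r ∈ Icc r₁ ρ, f r = 1 ∧ g r = s * (1 - r ^ 2))
    (hinner : ∀ r ∈ Icc 0 r₀, f r = r ^ 2 ∧ g r = 1 + δ - r ^ 2) :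
    AntitoneOn (fun r => (f r * g' r - f' r * g r) / ((1 + δ) * g' r)) (Ioc 0 ρ) ∧
    (∀ r ∈ Ioc 0 ρ,
      1 / (1 + δ) ≤ (f r * g' r - f' r * g r) / ((1 + δ) * g' r) ∧
      (f r * g' r - f' r * g r) / ((1 + δ) * g' r) ≤ 1) := by
  have hanti : AntitoneOn (fun r => (f r * g' r - f' r * g r) / ((1 + δ) * g' r))
      (Ioc 0 ρ) := by
    have hder : ∀ r ∈ Ioc 0 ρ, HasDerivWithinAt
        (fun r => (f r * g' r - f' r * g r) / ((1 + δ) * g' r))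
        (g r * (f' r * g'' r - f'' r * g' r) / ((1 + δ) * g' r ^ 2)) (Icc 0 ρ) r := by
      intro r hr
      have hr' := Ioc_subset_Icc_self hr
      exact (hf' r hr').wronskian_div (hg' r hr') (hf'' r hr') (hg'' r hr')
        (by positivity) (hg'neg r hr).ne
    refine antitoneOn_of_hasDerivWithinAt_nonpos (convex_Ioc 0 ρ)
      (fun r hr => (hder r hr).continuousWithinAt.mono Ioc_subset_Icc_self)
      (fun r hr => (hder r (interior_subset hr)).mono
        (interior_subset.trans Ioc_subset_Icc_self)) ?_
    intro r hr
    have hr' := Ioc_subset_Icc_self (interior_subset hr)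
    exact div_nonpos_of_nonpos_of_nonneg
      (mul_nonpos_of_nonneg_of_nonpos (hgpos r hr').le (hconv r hr')) (by positivity)
  refine ⟨hanti, fun r hr => ⟨?_, ?_⟩⟩
  · have hρ : ρ ∈ Ioc 0 ρ := ⟨by linarith, le_rfl⟩
    have hf'ρ : f' ρ = 0 :=
      (hf' ρ (Ioc_subset_Icc_self hρ)).eq_of_eqOn_Icc (hasDerivAt_const ρ (1 : ℝ)) h1ρ
        (Icc_subset_Icc_left (by linarith)) ⟨h1ρ.le, le_rfl⟩ fun x hx => (houter x hx).1
    refine le_of_eq_of_le ?_ (hanti hr hρ hr.2)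
    have := (hg'neg ρ hρ).ne
    simp only [hf'ρ, (houter ρ ⟨h1ρ.le, le_rfl⟩).1]
    field_simp
    ring
  · set m := min r r₀
    have hm0 : 0 < m := lt_min hr.1 h0
    have hm : m ∈ Icc 0 r₀ := ⟨hm0.le, min_le_right _ _⟩
    have hmρ : m ∈ Ioc 0 ρ := ⟨hm0, (min_le_left _ _).trans hr.2⟩
    have hsub : Icc 0 r₀ ⊆ Icc 0 ρ := Icc_subset_Icc_right (by linarith)
    have hsq : HasDerivAt (fun x : ℝ => x ^ 2) (2 * m) m := by
      simpa using hasDerivAt_pow 2 m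
    have hf'm : f' m = 2 * m :=
      (hf' m (hsub hm)).eq_of_eqOn_Icc hsq h0 hsub hm fun x hx => (hinner x hx).1
    have hg'm : g' m = -(2 * m) :=
      (hg' m (hsub hm)).eq_of_eqOn_Icc (hsq.const_sub (1 + δ)) h0 hsub hm
        fun x hx => (hinner x hx).2
    refine (hanti hmρ hr (min_le_left _ _)).trans_eq ?_
    simp only [hf'm, hg'm, (hinner m hm).1, (hinner m hm).2]
    field_simp
    ring
end
end
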